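/- arXiv:1110.6027 — 2 statements merged into one kernel-verified Lean document; each statement's English description precedes it below -/
import Mathlib

section
/- Let (X, Σ, μ) be a probability space and let Q ⊆ Σ be a family of measurable subsets of X. Then the weighted μ-entropy of Q coincides with the classical μ-entropy of Q, i.e. Hv(μ;Q) = H(μ;Q). -/
open MeasureTheory ENNReal

/-- The Shannon function `sh(x) = -x·log₂ x` (with `sh 0 = 0`). -/
noncomputable def sh (x : ℝ) : ℝ := -(x * Real.logb 2 x)

/-- `P` is a `μ`-partition of `X`: a countable family of pairwise disjoint
measurable sets covering `X` up to a `μ`-null set. -/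
def IsMuPartition {X : Type*} [MeasurableSpace X] (μ : Measure X) (P : Set (Set X)) : Prop :=
  P.Countable ∧ (∀ s ∈ P, MeasurableSet s) ∧ P.Pairwise Disjoint ∧ μ (⋃₀ P)ᶜ = 0

/-- The `μ`-entropy `h(μ;P) = Σ_{P∈P} sh(μ(P))` of a family of sets. -/
noncomputable def partEntropy {X : Type*} [MeasurableSpace X] (μ : Measure X)
    (P : Set (Set X)) : ℝ≥0∞ :=
  ∑' s : P, ENNReal.ofReal (sh (μ s).toReal)

/-- `P ≺ Q` : every element of `P` is contained in some element of `Q`. -/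
def Finer {X : Type*} (P Q : Set (Set X)) : Prop := ∀ p ∈ P, ∃ q ∈ Q, p ⊆ q

/-- The (classical) `μ`-entropy of a family `Q`:
`H(μ;Q) = inf { h(μ;P) : P a μ-partition, P ≺ Q }`, with `inf ∅ = ∞`. -/
noncomputable def entropyH {X : Type*} [MeasurableSpace X] (μ : Measure X)
    (Q : Set (Set X)) : ℝ≥0∞ :=
  ⨅ (P : Set (Set X)) (_ : IsMuPartition μ P) (_ : Finer P Q), partEntropy μ P

/-- `m ∈ V(μ;Q)` : a weighting of `Q`, i.e. `m : Q → Measure X` with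
`m_Q(X \ Q) = 0` for all `Q ∈ Q` and `Σ_{Q∈Q} m_Q = μ`. -/
def IsWeighting {X : Type*} [MeasurableSpace X] (μ : Measure X) (Q : Set (Set X))
    (m : Q → Measure X) : Prop :=
  (∀ q : Q, m q ((q : Set X))ᶜ = 0) ∧ Measure.sum m = μ

/-- The weighted `μ`-entropy of `m ∈ V(μ;Q)` : `hv(μ;m) = Σ_{Q∈Q} sh(m_Q(X))`. -/
noncomputable def wEntropy {X : Type*} [MeasurableSpace X] (Q : Set (Set X))
    (m : Q → Measure X) : ℝ≥0∞ :=
  ∑' q : Q, ENNReal.ofReal (sh ((m q) Set.univ).toReal)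

/-- The weighted `μ`-entropy of `Q` : `Hv(μ;Q) = inf { hv(μ;m) : m ∈ V(μ;Q) }`,
with `inf ∅ = ∞`. -/
noncomputable def entropyHv {X : Type*} [MeasurableSpace X] (μ : Measure X)
    (Q : Set (Set X)) : ℝ≥0∞ :=
  ⨅ (m : Q → Measure X) (_ : IsWeighting μ Q m), wEntropy Q m

/-- The family of all closed balls of radius `δ`. -/
def ballFam (X : Type*) [PseudoMetricSpace X] (δ : ℝ) : Set (Set X) :=
  Set.range (fun x : X => Metric.closedBall x δ)

/-- The lower entropy dimension `liminf_{δ→0⁺} H(μ;B_δ)/(-log₂ δ)`. -/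
noncomputable def ldimE {X : Type*} [PseudoMetricSpace X] [MeasurableSpace X]
    (μ : Measure X) : ℝ≥0∞ :=
  Filter.liminf (fun δ : ℝ => entropyH μ (ballFam X δ) / ENNReal.ofReal (-Real.logb 2 δ))
    (nhdsWithin 0 (Set.Ioi 0))

/-- The upper entropy dimension `limsup_{δ→0⁺} H(μ;B_δ)/(-log₂ δ)`. -/
noncomputable def udimE {X : Type*} [PseudoMetricSpace X] [MeasurableSpace X]
    (μ : Measure X) : ℝ≥0∞ :=
  Filter.limsup (fun δ : ℝ => entropyH μ (ballFam X δ) / ENNReal.ofReal (-Real.logb 2 δ))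
    (nhdsWithin 0 (Set.Ioi 0))

/-- `N_δ(S)` : the smallest number of closed balls of radius `δ` needed to cover `S`. -/
noncomputable def coverNum {X : Type*} [PseudoMetricSpace X] (S : Set X) (δ : ℝ) : ℝ≥0∞ :=
  ⨅ (t : Finset X) (_ : S ⊆ ⋃ x ∈ t, Metric.closedBall x δ), (t.card : ℝ≥0∞)

/-- The natural logarithm on `ℝ≥0∞` (with `log ∞ = ∞`), truncated to `ℝ≥0∞`. -/
noncomputable def logENN (x : ℝ≥0∞) : ℝ≥0∞ :=
  if x = ⊤ then ⊤ else ENNReal.ofReal (Real.log x.toReal)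

/-- The upper box dimension `limsup_{δ→0⁺} log N_δ(S)/(-log δ)`. -/
noncomputable def ubdimB {X : Type*} [PseudoMetricSpace X] (S : Set X) : ℝ≥0∞ :=
  Filter.limsup (fun δ : ℝ => logENN (coverNum S δ) / ENNReal.ofReal (-Real.log δ))
    (nhdsWithin 0 (Set.Ioi 0))

/-- The upper local dimension `D̄_μ(x) = limsup_{δ→0⁺} log μ(B(x,δ))/log δ`
(interpreted as `∞` when `μ(B(x,δ)) = 0`). -/
noncomputable def upLocalDim {X : Type*} [PseudoMetricSpace X] [MeasurableSpace X]
    (μ : Measure X) (x : X) : ℝ≥0∞ :=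
  Filter.limsup
    (fun δ : ℝ => if μ (Metric.closedBall x δ) = 0 then ⊤ else
      ENNReal.ofReal (Real.log (μ (Metric.closedBall x δ)).toReal / Real.log δ))
    (nhdsWithin 0 (Set.Ioi 0))

lemma ofReal_sh_toReal (x : ℝ≥0∞) :
    ENNReal.ofReal (sh x.toReal) =
      ENNReal.ofReal x.toReal * ENNReal.ofReal (-Real.logb 2 x.toReal) := by
  rw [sh, ← mul_neg, ENNReal.ofReal_mul ENNReal.toReal_nonneg]

/-- Countable subadditivity of the Shannon function. -/
lemma ofReal_sh_tsum_le {ι : Type*} (p : ι → ℝ≥0∞) (hp : ∑' i, p i ≠ ∞) :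
    ENNReal.ofReal (sh (∑' i, p i).toReal) ≤ ∑' i, ENNReal.ofReal (sh (p i).toReal) := by
  rw [ofReal_sh_toReal, ENNReal.ofReal_toReal hp, ← ENNReal.tsum_mul_right]
  refine ENNReal.tsum_le_tsum fun i => ?_
  have hle : p i ≤ ∑' i, p i := ENNReal.le_tsum i
  rw [ofReal_sh_toReal, ENNReal.ofReal_toReal (ne_top_of_le_ne_top hp hle)]
  rcases eq_or_ne (p i) 0 with h0 | h0
  · simp [h0]
  gcongr
  · norm_num
  · exact ENNReal.toReal_pos h0 (ne_top_of_le_ne_top hp hle)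

/-- Gibbs' inequality, with the cross entropy on the right-hand side. -/
lemma tsum_ofReal_sh_le_cross {ι : Type*} (p a : ι → ℝ≥0∞) (hp : ∑' i, p i = 1)
    (ha : ∑' i, a i = 1) (ha0 : ∀ i, a i ≠ 0) :
    ∑' i, ENNReal.ofReal (sh (p i).toReal) ≤
      ∑' i, p i * ENNReal.ofReal (-Real.logb 2 (a i).toReal) := by
  set L : ℝ≥0∞ := ENNReal.ofReal (Real.log 2)⁻¹
  have hlog : 0 < Real.log 2 := Real.log_pos one_lt_two
  have key : ∀ i, ENNReal.ofReal (sh (p i).toReal) + p i * L ≤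
      p i * ENNReal.ofReal (-Real.logb 2 (a i).toReal) + a i * L := by
    intro i
    have hp1 : p i ≤ 1 := hp ▸ ENNReal.le_tsum i
    have ha1 : a i ≤ 1 := ha ▸ ENNReal.le_tsum i
    have hpt : p i ≠ ∞ := ne_top_of_le_ne_top one_ne_top hp1
    have hat : a i ≠ ∞ := ne_top_of_le_ne_top one_ne_top ha1
    rcases eq_or_ne (p i) 0 with h0 | h0
    · simp [h0, sh]
    have hx : 0 < (p i).toReal := ENNReal.toReal_pos h0 hpt
    have hy : 0 < (a i).toReal := ENNReal.toReal_pos (ha0 i) hat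
    have hx1 : (p i).toReal ≤ 1 := ENNReal.toReal_mono one_ne_top hp1
    have hy1 : (a i).toReal ≤ 1 := ENNReal.toReal_mono one_ne_top ha1
    rw [← ENNReal.ofReal_toReal hpt, ← ENNReal.ofReal_toReal hat]
    simp only [ENNReal.toReal_ofReal hx.le, ENNReal.toReal_ofReal hy.le]
    generalize (p i).toReal = x at *
    generalize (a i).toReal = y at *
    have hlx : Real.log x ≤ 0 := Real.log_nonpos hx.le hx1
    have hly : Real.log y ≤ 0 := Real.log_nonpos hy.le hy1
    have hsx : 0 ≤ sh x := by
      rw [sh, ← mul_neg, Real.logb, ← neg_div]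
      exact mul_nonneg hx.le (div_nonneg (neg_nonneg.2 hlx) hlog.le)
    have hcy : 0 ≤ -Real.logb 2 y := by
      rw [Real.logb, ← neg_div]
      exact div_nonneg (neg_nonneg.2 hly) hlog.le
    rw [← ENNReal.ofReal_mul hx.le, ← ENNReal.ofReal_mul hx.le, ← ENNReal.ofReal_mul hy.le,
      ← ENNReal.ofReal_add hsx (by positivity),
      ← ENNReal.ofReal_add (mul_nonneg hx.le hcy) (by positivity)]
    refine ENNReal.ofReal_le_ofReal ?_
    have h := Real.log_le_sub_one_of_pos (div_pos hy hx)
    rw [Real.log_div hy.ne' hx.ne'] at h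
    have h2 : x * (Real.log y - Real.log x) ≤ y - x := by
      calc _ ≤ x * (y / x - 1) := by gcongr
        _ = y - x := by field_simp
    have h3 := mul_le_mul_of_nonneg_right h2 (inv_nonneg.2 hlog.le)
    simp only [sh, Real.logb, div_eq_mul_inv]
    linarith
  have h := ENNReal.tsum_le_tsum key
  rw [ENNReal.tsum_add, ENNReal.tsum_add, ENNReal.tsum_mul_right, ENNReal.tsum_mul_right,
    hp, ha, one_mul] at h
  exact (ENNReal.add_le_add_iff_right ENNReal.ofReal_ne_top).1 h

/-- Disjointification of a countable family of sets, removing from each set all those that come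
earlier in an order of decreasing weights. -/
lemma exists_disjoint_refinement {X ι : Type*} [MeasurableSpace X] [Countable ι]
    (a : ι → ℝ≥0∞) (ha : ∑' i, a i ≠ ∞) (ha0 : ∀ i, a i ≠ 0)
    (A : ι → Set X) (hA : ∀ i, MeasurableSet (A i)) :
    ∃ P : ι → Set X, (∀ i, MeasurableSet (P i)) ∧ (∀ i, P i ⊆ A i) ∧
      Pairwise (Function.onFun Disjoint P) ∧ (∀ i, A i ⊆ ⋃ j, P j) ∧
      ∀ i j, (P i ∩ A j).Nonempty → a j ≤ a i := by
  obtain ⟨e, he⟩ := Countable.exists_injective_nat ι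
  set k : ι → ℝ≥0∞ᵒᵈ ×ₗ ℕ := fun i => toLex (OrderDual.toDual (a i), e i)
  have hk : Function.Injective k := fun i j h => he (congrArg (fun z => (ofLex z).2) h)
  have hka : ∀ i j, k i ≤ k j → a j ≤ a i := fun i j h =>
    OrderDual.toDual_le_toDual.1 (Prod.Lex.monotone_fst _ _ h)
  refine ⟨fun i => A i \ ⋃ j ∈ {j | k j < k i}, A j, fun i => ?_, fun i => Set.sdiff_subset,
    ?_, ?_, ?_⟩
  · exact (hA i).diff (MeasurableSet.biUnion (Set.to_countable _) fun j _ => hA j)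
  · intro i j hij
    refine Set.disjoint_left.2 fun x hxi hxj => ?_
    rcases lt_or_gt_of_ne (hk.ne hij) with h | h
    · exact hxj.2 (Set.mem_biUnion (show i ∈ {l | k l < k j} from h) hxi.1)
    · exact hxi.2 (Set.mem_biUnion (show j ∈ {l | k l < k i} from h) hxj.1)
  · intro i x hx
    have hfin : {j | a i ≤ a j ∧ x ∈ A j}.Finite :=
      (ENNReal.finite_const_le_of_tsum_ne_top ha (ha0 i)).subset fun j hj => hj.1
    obtain ⟨j, hj, hmin⟩ := Set.exists_min_image _ k hfin ⟨i, le_rfl, hx⟩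
    refine Set.mem_iUnion.2 ⟨j, hj.2, fun hmem => ?_⟩
    obtain ⟨l, hl, hxl⟩ := Set.mem_iUnion₂.1 hmem
    exact (hmin l ⟨hj.1.trans (hka l j (le_of_lt hl)), hxl⟩).not_gt hl
  · rintro i j ⟨x, hx, hxj⟩
    refine hka i j (not_lt.1 fun h => hx.2 (Set.mem_biUnion (show j ∈ {l | k l < k i} from h) hxj))

/-- Passing to the set of values of an indexed family does not increase the entropy. -/
lemma partEntropy_range_le {X ι : Type*} [MeasurableSpace X] (μ : Measure X) (P : ι → Set X) :
    partEntropy μ (Set.range P) ≤ ∑' i, ENNReal.ofReal (sh (μ (P i)).toReal) := by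
  choose g hg using fun s : Set.range P => s.2
  have hinj : Function.Injective g := fun s t h => Subtype.ext (by rw [← hg s, ← hg t, h])
  calc partEntropy μ (Set.range P)
      = ∑' s : Set.range P, ENNReal.ofReal (sh (μ (P (g s))).toReal) := by
        simp only [partEntropy, hg]
    _ ≤ _ := ENNReal.tsum_comp_le_tsum_of_injective hinj
        fun i => ENNReal.ofReal (sh (μ (P i)).toReal)

/-- A countable decomposition of `μ` into nonzero measures carried by the sets `A i` is dominated
in entropy by a disjoint refinement of the family `A`. -/
lemma exists_refinement_entropy_le {X ι : Type*} [MeasurableSpace X] [Countable ι]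
    (μ : Measure X) [IsProbabilityMeasure μ] (A : ι → Set X) (hA : ∀ i, MeasurableSet (A i))
    (m : ι → Measure X) (hm : ∀ i, m i (A i)ᶜ = 0) (hsum : Measure.sum m = μ)
    (hm0 : ∀ i, m i Set.univ ≠ 0) :
    ∃ P : ι → Set X, (∀ i, P i ⊆ A i) ∧ IsMuPartition μ (Set.range P) ∧
      ∑' i, ENNReal.ofReal (sh (μ (P i)).toReal) ≤
        ∑' i, ENNReal.ofReal (sh (m i Set.univ).toReal) := by
  have happly : ∀ s, MeasurableSet s → ∑' i, m i s = μ s := fun s hs => by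
    rw [← hsum, Measure.sum_apply _ hs]
  have ha : ∑' i, m i Set.univ = 1 := by rw [happly _ .univ, measure_univ]
  have hat : ∀ i, m i Set.univ ≠ ∞ := fun i =>
    ne_top_of_le_ne_top one_ne_top (ha ▸ ENNReal.le_tsum i)
  obtain ⟨P, hPm, hPA, hPd, hAP, hP⟩ :=
    exists_disjoint_refinement (fun i => m i Set.univ) (by simp [ha]) hm0 A hA
  have hcover : μ (⋃ i, P i)ᶜ = 0 := by
    rw [← happly _ (MeasurableSet.iUnion hPm).compl, ENNReal.tsum_eq_zero]
    exact fun i => measure_mono_null (Set.compl_subset_compl.2 (hAP i)) (hm i)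
  have hP1 : ∑' i, μ (P i) = 1 := by
    rw [← measure_iUnion hPd hPm, ← prob_compl_eq_zero_iff (MeasurableSet.iUnion hPm)]
    exact hcover
  refine ⟨P, hPA, ⟨Set.countable_range P, ?_, ?_, ?_⟩, ?_⟩
  · rintro _ ⟨i, rfl⟩
    exact hPm i
  · rintro _ ⟨i, rfl⟩ _ ⟨j, rfl⟩ hij
    exact hPd fun h => hij (h ▸ rfl)
  · rwa [Set.sUnion_range]
  refine (tsum_ofReal_sh_le_cross _ _ hP1 ha hm0).trans ?_
  set c : ι → ℝ≥0∞ := fun i => ENNReal.ofReal (-Real.logb 2 (m i Set.univ).toReal)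
  calc ∑' i, μ (P i) * c i = ∑' i, ∑' j, m j (P i) * c i := by
        simp_rw [ENNReal.tsum_mul_right, happly _ (hPm _)]
    _ ≤ ∑' i, ∑' j, m j (P i) * c j := by
        refine ENNReal.tsum_le_tsum fun i => ENNReal.tsum_le_tsum fun j => ?_
        rcases (P i ∩ A j).eq_empty_or_nonempty with h | h
        · have : m j (P i) = 0 := measure_mono_null
            (Set.disjoint_iff_inter_eq_empty.2 h).subset_compl_right (hm j)
          simp [this]
        · have hle := ENNReal.toReal_mono (hat i) (hP i j h)
          have hpos := ENNReal.toReal_pos (hm0 j) (hat j)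
          have := Real.logb_le_logb_of_le one_lt_two hpos hle
          exact mul_le_mul_right (ENNReal.ofReal_le_ofReal (neg_le_neg this)) _
    _ = ∑' j, m j (⋃ i, P i) * c j := by
        rw [ENNReal.tsum_comm]
        simp_rw [ENNReal.tsum_mul_right, measure_iUnion hPd hPm]
    _ ≤ ∑' j, m j Set.univ * c j := ENNReal.tsum_le_tsum fun j =>
        mul_le_mul_left (measure_mono (Set.subset_univ _)) _
    _ = _ := by
        simp_rw [ofReal_sh_toReal, ENNReal.ofReal_toReal (hat _), c]

lemma entropyH_le_wEntropy {X : Type*} [MeasurableSpace X]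
    (μ : Measure X) [IsProbabilityMeasure μ]
    (Q : Set (Set X)) (hQ : ∀ q ∈ Q, MeasurableSet q)
    (m : Q → Measure X) (hm : IsWeighting μ Q m) :
    entropyH μ Q ≤ wEntropy Q m := by
  obtain ⟨hm, hsum⟩ := hm
  set S : Set Q := Function.support fun q => m q Set.univ
  have ha : ∑' q, m q Set.univ = 1 := by
    rw [← Measure.sum_apply _ .univ, hsum, measure_univ]
  have : Countable S := (Summable.countable_support_ennreal (by simp [ha])).to_subtype
  have hS : Measure.sum (fun q : S => m q) = μ := by
    rw [← hsum]
    ext s hs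
    rw [Measure.sum_apply _ hs, Measure.sum_apply _ hs]
    refine tsum_subtype_eq_of_support_subset (f := fun q => m q s) fun q hq h => hq ?_
    exact measure_mono_null (Set.subset_univ s) h
  obtain ⟨P, hPA, hP, hle⟩ := exists_refinement_entropy_le μ (fun q : S => (q : Set X))
    (fun q => hQ _ q.1.2) (fun q => m q) (fun q => hm q) hS (fun q => q.2)
  calc entropyH μ Q ≤ partEntropy μ (Set.range P) := by
        refine iInf₂_le_of_le _ hP (iInf_le _ ?_)
        rintro _ ⟨q, rfl⟩
        exact ⟨q, q.1.2, hPA q⟩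
    _ ≤ _ := partEntropy_range_le μ P
    _ ≤ _ := hle
    _ ≤ wEntropy Q m := ENNReal.tsum_comp_le_tsum_of_injective Subtype.val_injective
        fun q => ENNReal.ofReal (sh (m q Set.univ).toReal)

lemma entropyHv_le_partEntropy {X : Type*} [MeasurableSpace X]
    (μ : Measure X) [IsProbabilityMeasure μ]
    (Q : Set (Set X)) (hQ : ∀ q ∈ Q, MeasurableSet q)
    (P : Set (Set X)) (hP : IsMuPartition μ P) (hPQ : Finer P Q) :
    entropyHv μ Q ≤ partEntropy μ P := by
  classical
  obtain ⟨hc, hPm, hd, hcover⟩ := hP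
  have : Countable P := hc.to_subtype
  choose g hgQ hg using fun p : P => hPQ p p.2
  set f : P → Q := fun p => ⟨g p, hgQ p⟩
  set m : Q → Measure X := fun q =>
    Measure.sum fun p : P => if f p = q then μ.restrict p else 0
  have hfin : ∀ q s, MeasurableSet s → m q s = ∑' p : P, if f p = q then μ (s ∩ p) else 0 := by
    intro q s hs
    rw [Measure.sum_apply _ hs]
    refine tsum_congr fun p => ?_
    split_ifs <;> simp [Measure.restrict_apply hs]
  have hsum : Measure.sum m = μ := by
    have hres : Measure.sum (fun p : P => μ.restrict p) = μ := by
      rw [← Measure.restrict_iUnion (fun p q hpq => hd p.2 q.2 (Subtype.coe_injective.ne hpq))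
        (fun p : P => hPm p p.2), ← Set.sUnion_eq_iUnion]
      exact Measure.restrict_eq_self_of_ae_mem (mem_ae_iff.2 hcover)
    conv_rhs => rw [← hres]
    ext s hs
    rw [Measure.sum_apply _ hs, Measure.sum_apply _ hs]
    simp_rw [hfin _ s hs]
    rw [ENNReal.tsum_comm]
    refine tsum_congr fun p => ?_
    rw [Measure.restrict_apply hs]
    exact tsum_ite_eq' (f p) fun _ => μ (s ∩ p)
  have hw : IsWeighting μ Q m := by
    refine ⟨fun q => ?_, hsum⟩
    rw [hfin q _ (hQ q q.2).compl, ENNReal.tsum_eq_zero]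
    intro p
    split_ifs with h
    · have hsub : (p : Set X) ⊆ q := h ▸ hg p
      rw [(Set.disjoint_compl_left_iff_subset.2 hsub).inter_eq, measure_empty]
    · rfl
  calc entropyHv μ Q ≤ wEntropy Q m := iInf₂_le _ hw
    _ ≤ ∑' q : Q, ∑' p : P, if f p = q then ENNReal.ofReal (sh (μ p).toReal) else 0 := by
        refine ENNReal.tsum_le_tsum fun q => ?_
        have h1 : m q Set.univ ≤ 1 := by
          have : m q Set.univ ≤ Measure.sum m Set.univ := Measure.le_sum m q _
          rwa [hsum, measure_univ (μ := μ)] at this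
        have h := hfin q Set.univ .univ
        simp only [Set.univ_inter] at h
        rw [h] at h1 ⊢
        refine (ofReal_sh_tsum_le _ (ne_top_of_le_ne_top one_ne_top h1)).trans_eq ?_
        refine tsum_congr fun p => ?_
        split_ifs <;> simp [sh]
    _ = partEntropy μ P := by
        rw [ENNReal.tsum_comm]
        exact tsum_congr fun p => tsum_ite_eq' (f p) fun _ => ENNReal.ofReal (sh (μ p).toReal)

/-- Theorem 1 of the paper: for a probability measure `μ` and a family
`Q ⊆ Σ` of measurable sets, the weighted entropy coincides with the classical entropy:
`Hv(μ;Q) = H(μ;Q)`. -/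
theorem weighted_entropy_eq_entropy {X : Type*} [MeasurableSpace X]
    (μ : Measure X) [IsProbabilityMeasure μ]
    (Q : Set (Set X)) (hQ : ∀ q ∈ Q, MeasurableSet q) :
    entropyHv μ Q = entropyH μ Q := by
  apply le_antisymm
  · exact le_iInf fun P => le_iInf₂ fun hP hPQ => entropyHv_le_partEntropy μ Q hQ P hP hPQ
  · exact le_iInf₂ fun m hm => entropyH_le_wEntropy μ Q hQ m hm
end

section
/- Let (X, Σ) be a measurable space, let a₁, a₂ ∈ (0,1) with a₁ + a₂ = 1, let μ₁, μ₂ be probability measures on (X,Σ), and let Q ⊆ Σ. Then a₁ H(μ₁;Q) + a₂ H(μ₂;Q) ≤ H(a₁μ₁ + a₂μ₂; Q) ≤ a₁ H(μ₁;Q) + a₂ H(μ₂;Q) + 1. -/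
open MeasureTheory ENNReal

lemma sh_eq_negMulLog_div (x : ℝ) : sh x = Real.negMulLog x / Real.log 2 := by
  simp only [sh, Real.negMulLog, Real.logb]
  ring

lemma sh_nonneg {x : ℝ} (h0 : 0 ≤ x) (h1 : x ≤ 1) : 0 ≤ sh x := by
  rw [sh_eq_negMulLog_div]
  exact div_nonneg (Real.negMulLog_nonneg h0 h1) (Real.log_nonneg one_le_two)

lemma sh_mul (x y : ℝ) : sh (x * y) = y * sh x + x * sh y := by
  simp only [sh_eq_negMulLog_div, Real.negMulLog_mul]
  ring

lemma concaveOn_sh : ConcaveOn ℝ (Set.Ici 0) sh := by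
  have h : sh = (Real.log 2)⁻¹ • Real.negMulLog := by
    ext x
    simp [sh_eq_negMulLog_div, div_eq_inv_mul]
  rw [h]
  exact Real.concaveOn_negMulLog.smul (inv_nonneg.2 (Real.log_nonneg one_le_two))

lemma sh_add_sh_le_one {a b : ℝ} (hab : a + b = 1) : sh a + sh b ≤ 1 := by
  have hb : b = 1 - a := by linarith
  rw [hb, sh_eq_negMulLog_div, sh_eq_negMulLog_div, ← add_div,
    ← Real.binEntropy_eq_negMulLog_add_negMulLog_one_sub, div_le_one (Real.log_pos one_lt_two)]
  exact Real.binEntropy_le_log_two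

/-- The pointwise Gibbs inequality. -/
lemma sh_add_div_log_two_le {p w : ℝ} (hp : 0 ≤ p) (hw : 0 < w) :
    sh p + p / Real.log 2 ≤ p * -Real.logb 2 w + w / Real.log 2 := by
  have hlog : 0 < Real.log 2 := Real.log_pos one_lt_two
  suffices h : Real.negMulLog p + p ≤ p * -Real.log w + w by
    have := div_le_div_of_nonneg_right h hlog.le
    rwa [add_div, add_div, mul_div_assoc, neg_div, ← sh_eq_negMulLog_div] at this
  rcases hp.eq_or_lt with rfl | hp
  · simpa using hw.le
  · have h := Real.log_le_sub_one_of_pos (div_pos hw hp)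
    rw [Real.log_div hw.ne' hp.ne'] at h
    have h' := mul_le_mul_of_nonneg_left h hp.le
    have : p * (w / p - 1) = w - p := by field_simp
    simp only [Real.negMulLog]
    linarith

/-- A countable family of sets with summable weights can be disjointified so that each point covered
by a set of nonzero weight is assigned to a set of maximal weight containing it. -/
lemma exists_disjoint_of_summable_weight {X ι : Type*} [MeasurableSpace X] [Countable ι]
    (A : ι → Set X) (hA : ∀ i, MeasurableSet (A i)) (w : ι → ℝ≥0∞) (hw : ∑' i, w i ≠ ∞) :
    ∃ P : ι → Set X, (∀ i, MeasurableSet (P i)) ∧ (∀ i, P i ⊆ A i) ∧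
      Pairwise (Function.onFun Disjoint P) ∧ (∀ i, w i = 0 → P i = ∅) ∧
      (∀ i, w i ≠ 0 → A i ⊆ ⋃ j, P j) ∧
      ∀ i j, (P i ∩ A j).Nonempty → w j ≤ w i := by
  obtain ⟨e, he⟩ := exists_injective_nat ι
  let k : ι → ℝ≥0∞ᵒᵈ ×ₗ ℕ := fun i => toLex (OrderDual.toDual (w i), e i)
  have hk : Function.Injective k := fun i j h => he (congrArg (fun z => (ofLex z).2) h)
  have hkw : ∀ i j, k i ≤ k j → w j ≤ w i := fun i j h => by
    rcases Prod.Lex.toLex_le_toLex.1 h with h | h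
    · exact (OrderDual.toDual_lt_toDual.1 h).le
    · exact (OrderDual.toDual_inj.1 h.1).ge
  refine ⟨fun i => {x | w i ≠ 0 ∧ x ∈ A i ∧ ∀ j, x ∈ A j → k i ≤ k j}, ?_, ?_, ?_, ?_, ?_, ?_⟩
  · intro i
    have hmin : {x | ∀ j, x ∈ A j → k i ≤ k j} = ⋂ j, {x | x ∈ A j → k i ≤ k j} := by
      ext x
      simp
    refine (MeasurableSet.const _).inter ((hA i).inter ?_)
    change MeasurableSet {x | ∀ j, x ∈ A j → k i ≤ k j}
    rw [hmin]
    exact MeasurableSet.iInter fun j => (hA j).imp (MeasurableSet.const _)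
  · exact fun i x hx => hx.2.1
  · intro i j hij
    refine Set.disjoint_left.2 fun x hi hj => hij (hk ?_)
    exact (hi.2.2 j hj.2.1).antisymm (hj.2.2 i hi.2.1)
  · intro i hi
    simp [hi]
  · intro i hi x hx
    have hfin : {j | w i ≤ w j ∧ x ∈ A j}.Finite :=
      (ENNReal.finite_const_le_of_tsum_ne_top hw hi).subset fun j hj => hj.1
    obtain ⟨j, hj, hmin⟩ := Set.exists_min_image _ k hfin ⟨i, le_rfl, hx⟩
    refine Set.mem_iUnion.2 ⟨j, (hi.bot_lt.trans_le hj.1).ne', hj.2, fun l hl => ?_⟩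
    by_cases hil : w i ≤ w l
    · exact hmin l ⟨hil, hl⟩
    · by_contra hlt
      exact hil (hj.1.trans (hkw l j (not_le.1 hlt).le))
  · rintro i j ⟨x, hx, hxj⟩
    exact hkw i j (hx.2.2 j hxj)

lemma tsum_measure_eq_one {X ι : Type*} [MeasurableSpace X] [Countable ι] {μ : Measure X}
    [IsProbabilityMeasure μ] {P : ι → Set X} (hP : ∀ i, MeasurableSet (P i))
    (hd : Pairwise (Function.onFun Disjoint P)) (hc : μ (⋃ i, P i)ᶜ = 0) :
    ∑' i, μ (P i) = 1 := by
  rw [← measure_iUnion hd hP]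
  exact (prob_compl_eq_zero_iff (MeasurableSet.iUnion hP)).1 hc

/-- Weighted entropies bound the entropy from above. -/
lemma entropyH_le_tsum_of_sum_eq {X ι : Type*} [MeasurableSpace X] [Countable ι]
    (μ : Measure X) [IsProbabilityMeasure μ] (Q : Set (Set X)) (A : ι → Set X)
    (hA : ∀ i, MeasurableSet (A i)) (hAQ : ∀ i, ∃ q ∈ Q, A i ⊆ q)
    (m : ι → Measure X) (hm : ∀ i, m i (A i)ᶜ = 0) (hsum : Measure.sum m = μ) :
    entropyH μ Q ≤ ∑' i, ENNReal.ofReal (sh (m i Set.univ).toReal) := by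
  set w : ι → ℝ≥0∞ := fun i => m i Set.univ
  have hw1 : ∑' i, w i = 1 := by
    rw [← measure_univ (μ := μ), ← hsum, Measure.sum_apply _ MeasurableSet.univ]
  have hwle : ∀ i, w i ≤ 1 := fun i => hw1 ▸ ENNReal.le_tsum i
  have hwtop : ∀ i, w i ≠ ∞ := fun i => ne_top_of_le_ne_top one_ne_top (hwle i)
  obtain ⟨P, hPm, hPA, hPd, hP0, hPc, hPw⟩ :=
    exists_disjoint_of_summable_weight A hA w (hw1 ▸ one_ne_top)
  have hcover : μ (⋃ i, P i)ᶜ = 0 := by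
    rw [← hsum, Measure.sum_apply_eq_zero]
    intro i
    by_cases hi : w i = 0
    · exact measure_mono_null (Set.subset_univ _) hi
    · exact measure_mono_null (Set.compl_subset_compl.2 (hPc i hi)) (hm i)
  have hp1 : ∑' i, μ (P i) = 1 := tsum_measure_eq_one hPm hPd hcover
  have hrange : IsMuPartition μ (Set.range P) := by
    refine ⟨Set.countable_range P, ?_, ?_, by rwa [Set.sUnion_range]⟩
    · rintro _ ⟨i, rfl⟩
      exact hPm i
    · rintro _ ⟨i, rfl⟩ _ ⟨j, rfl⟩ hij
      exact hPd fun h => hij (h ▸ rfl)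
  have hfiner : Finer (Set.range P) Q := by
    rintro _ ⟨i, rfl⟩
    obtain ⟨q, hq, hAq⟩ := hAQ i
    exact ⟨q, hq, (hPA i).trans hAq⟩
  set c : ι → ℝ≥0∞ := fun i => ENNReal.ofReal (-Real.logb 2 (w i).toReal)
  have hcross : ∑' i, μ (P i) * c i ≤ ∑' j, w j * c j := by
    calc ∑' i, μ (P i) * c i
        = ∑' i, ∑' j, m j (P i) * c i := by
          refine tsum_congr fun i => ?_
          rw [← hsum, Measure.sum_apply _ (hPm i), ENNReal.tsum_mul_right]
      _ ≤ ∑' i, ∑' j, m j (P i) * c j := by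
          refine ENNReal.tsum_le_tsum fun i => ENNReal.tsum_le_tsum fun j => ?_
          by_cases h0 : m j (P i) = 0
          · simp [h0]
          · have hne : (P i ∩ A j).Nonempty := by
              by_contra hemp
              refine h0 (measure_mono_null (fun x hx hxA => hemp ⟨x, hx, hxA⟩) (hm j))
            have hwj : w j ≠ 0 := fun h => h0 (measure_mono_null (Set.subset_univ _) h)
            refine mul_le_mul_right (ENNReal.ofReal_le_ofReal (neg_le_neg ?_)) _
            exact Real.logb_le_logb_of_le one_lt_two (ENNReal.toReal_pos hwj (hwtop j))
              (ENNReal.toReal_mono (hwtop i) (hPw i j hne))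
      _ = ∑' j, (∑' i, m j (P i)) * c j := by
          rw [ENNReal.tsum_comm]
          simp_rw [ENNReal.tsum_mul_right]
      _ ≤ ∑' j, w j * c j := by
          refine ENNReal.tsum_le_tsum fun j => mul_le_mul_left ?_ _
          exact tsum_measure_le_measure_univ (fun i => (hPm i).nullMeasurableSet)
            hPd.aedisjoint
  have hwc : ∀ j, w j * c j = ENNReal.ofReal (sh (w j).toReal) := fun j => by
    rw [sh, ← mul_neg, ENNReal.ofReal_mul toReal_nonneg, ofReal_toReal (hwtop j)]
  set L : ℝ≥0∞ := ENNReal.ofReal (1 / Real.log 2)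
  have hgibbs : ∀ i, ENNReal.ofReal (sh (μ (P i)).toReal) + μ (P i) * L ≤
      μ (P i) * c i + w i * L := fun i => by
    by_cases hi : w i = 0
    · simp [hP0 i hi, sh]
    · have hlog : 0 ≤ 1 / Real.log 2 := one_div_nonneg.2 (Real.log_nonneg one_le_two)
      have hpt : μ (P i) ≠ ∞ := measure_ne_top _ _
      have hwpos := ENNReal.toReal_pos hi (hwtop i)
      have hp : (μ (P i)).toReal ≤ 1 :=
        toReal_le_of_le_ofReal zero_le_one (by simpa using prob_le_one)
      have hwr : (w i).toReal ≤ 1 := toReal_le_of_le_ofReal zero_le_one (by simpa using hwle i)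
      have hcnn : 0 ≤ -Real.logb 2 (w i).toReal :=
        neg_nonneg.2 (Real.logb_nonpos one_lt_two toReal_nonneg hwr)
      have h := ENNReal.ofReal_le_ofReal
        (sh_add_div_log_two_le (toReal_nonneg (a := μ (P i))) hwpos)
      rw [div_eq_mul_one_div, div_eq_mul_one_div (w i).toReal,
        ENNReal.ofReal_add (sh_nonneg toReal_nonneg hp) (mul_nonneg toReal_nonneg hlog),
        ENNReal.ofReal_add (mul_nonneg toReal_nonneg hcnn) (mul_nonneg toReal_nonneg hlog),
        ENNReal.ofReal_mul toReal_nonneg, ENNReal.ofReal_mul toReal_nonneg,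
        ENNReal.ofReal_mul toReal_nonneg, ofReal_toReal hpt, ofReal_toReal (hwtop i)] at h
      exact h
  calc entropyH μ Q ≤ partEntropy μ (Set.range P) :=
        iInf_le_of_le _ (iInf_le_of_le hrange (iInf_le _ hfiner))
    _ ≤ ∑' i, ENNReal.ofReal (sh (μ (P i)).toReal) := by
        have h := ENNReal.tsum_comp_le_tsum_of_injective (Set.rangeSplitting_injective P)
          fun i => ENNReal.ofReal (sh (μ (P i)).toReal)
        simpa only [partEntropy, Set.apply_rangeSplitting] using h
    _ ≤ ∑' i, μ (P i) * c i := by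
        have h := ENNReal.tsum_le_tsum hgibbs
        rw [ENNReal.tsum_add, ENNReal.tsum_add, ENNReal.tsum_mul_right, ENNReal.tsum_mul_right,
          hp1, hw1, one_mul] at h
        exact (ENNReal.add_le_add_iff_right ofReal_ne_top).1 h
    _ ≤ ∑' i, ENNReal.ofReal (sh (w i).toReal) := hcross.trans_eq (tsum_congr hwc)

namespace IsMuPartition

variable {X : Type*} [MeasurableSpace X] {μ : Measure X} {P : Set (Set X)}

lemma pairwise_disjoint_coe (hP : IsMuPartition μ P) :
    Pairwise (Function.onFun Disjoint ((↑) : P → Set X)) :=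
  fun i j hij => hP.2.2.1 i.2 j.2 (Subtype.coe_ne_coe.2 hij)

lemma tsum_measure_eq_one [IsProbabilityMeasure μ] (hP : IsMuPartition μ P) :
    ∑' s : P, μ s = 1 := by
  have := hP.1.to_subtype
  refine _root_.tsum_measure_eq_one (fun s : P => hP.2.1 s s.2) hP.pairwise_disjoint_coe ?_
  rw [← Set.sUnion_eq_iUnion]
  exact hP.2.2.2

lemma sum_restrict (hP : IsMuPartition μ P) :
    Measure.sum (fun s : P => μ.restrict s) = μ := by
  have := hP.1.to_subtype
  rw [← Measure.restrict_iUnion hP.pairwise_disjoint_coe (fun s => hP.2.1 s s.2),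
    ← Set.sUnion_eq_iUnion]
  exact Measure.restrict_eq_self_of_ae_mem hP.2.2.2

/-- Rescaling a probability measure by `a` changes the entropy of a partition to
`a * h(μ;P) + sh a`. -/
lemma tsum_sh_smul [IsProbabilityMeasure μ] (hP : IsMuPartition μ P) {a : ℝ}
    (ha0 : 0 ≤ a) (ha1 : a ≤ 1) :
    ∑' s : P, ENNReal.ofReal (sh (ENNReal.ofReal a * μ s).toReal) =
      ENNReal.ofReal a * partEntropy μ P + ENNReal.ofReal (sh a) := by
  have h : ∀ s : P, ENNReal.ofReal (sh (ENNReal.ofReal a * μ s).toReal) =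
      ENNReal.ofReal a * ENNReal.ofReal (sh (μ s).toReal) + μ s * ENNReal.ofReal (sh a) := by
    intro s
    have hs : (μ s).toReal ≤ 1 := toReal_le_of_le_ofReal zero_le_one (by simpa using prob_le_one)
    rw [toReal_mul, toReal_ofReal ha0, sh_mul, add_comm,
      ENNReal.ofReal_add (mul_nonneg ha0 (sh_nonneg toReal_nonneg hs))
        (mul_nonneg toReal_nonneg (sh_nonneg ha0 ha1)),
      ENNReal.ofReal_mul ha0, ENNReal.ofReal_mul toReal_nonneg, ofReal_toReal (measure_ne_top _ _)]
  rw [tsum_congr h, ENNReal.tsum_add, ENNReal.tsum_mul_left, ENNReal.tsum_mul_right,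
    hP.tsum_measure_eq_one, one_mul, partEntropy]

end IsMuPartition

lemma isProbabilityMeasure_mixture {X : Type*} [MeasurableSpace X] {a₁ a₂ : ℝ}
    (ha₁ : 0 ≤ a₁) (ha₂ : 0 ≤ a₂) (hsum : a₁ + a₂ = 1) (μ₁ μ₂ : Measure X)
    [IsProbabilityMeasure μ₁] [IsProbabilityMeasure μ₂] :
    IsProbabilityMeasure (ENNReal.ofReal a₁ • μ₁ + ENNReal.ofReal a₂ • μ₂) :=
  ⟨by simp [← ENNReal.ofReal_add ha₁ ha₂, hsum]⟩

lemma le_partEntropy_mixture {X : Type*} [MeasurableSpace X] {a₁ a₂ : ℝ}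
    (ha₁ : 0 ≤ a₁) (ha₂ : 0 ≤ a₂) (hsum : a₁ + a₂ = 1) (μ₁ μ₂ : Measure X)
    [IsProbabilityMeasure μ₁] [IsProbabilityMeasure μ₂] (P : Set (Set X)) :
    ENNReal.ofReal a₁ * partEntropy μ₁ P + ENNReal.ofReal a₂ * partEntropy μ₂ P ≤
      partEntropy (ENNReal.ofReal a₁ • μ₁ + ENNReal.ofReal a₂ • μ₂) P := by
  simp only [partEntropy, ← ENNReal.tsum_mul_left, ← ENNReal.tsum_add]
  refine ENNReal.tsum_le_tsum fun s => ?_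
  have h₁ : (μ₁ s).toReal ≤ 1 := toReal_le_of_le_ofReal zero_le_one (by simpa using prob_le_one)
  have h₂ : (μ₂ s).toReal ≤ 1 := toReal_le_of_le_ofReal zero_le_one (by simpa using prob_le_one)
  rw [← ENNReal.ofReal_mul ha₁, ← ENNReal.ofReal_mul ha₂,
    ← ENNReal.ofReal_add (mul_nonneg ha₁ (sh_nonneg toReal_nonneg h₁))
      (mul_nonneg ha₂ (sh_nonneg toReal_nonneg h₂))]
  refine ENNReal.ofReal_le_ofReal ?_
  have h := concaveOn_sh.2 (toReal_nonneg (a := μ₁ s)) (toReal_nonneg (a := μ₂ s)) ha₁ ha₂ hsum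
  rw [Measure.add_apply, Measure.smul_apply, Measure.smul_apply, smul_eq_mul, smul_eq_mul,
    toReal_add (mul_ne_top ofReal_ne_top (measure_ne_top _ _))
      (mul_ne_top ofReal_ne_top (measure_ne_top _ _)),
    toReal_mul, toReal_mul, toReal_ofReal ha₁, toReal_ofReal ha₂]
  exact h

lemma entropyH_mixture_le {X : Type*} [MeasurableSpace X] {a₁ a₂ : ℝ}
    (ha₁ : 0 ≤ a₁) (ha₂ : 0 ≤ a₂) (hsum : a₁ + a₂ = 1) (μ₁ μ₂ : Measure X)
    [IsProbabilityMeasure μ₁] [IsProbabilityMeasure μ₂] {P₁ P₂ Q : Set (Set X)}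
    (hP₁ : IsMuPartition μ₁ P₁) (hP₂ : IsMuPartition μ₂ P₂)
    (hQ₁ : Finer P₁ Q) (hQ₂ : Finer P₂ Q) :
    entropyH (ENNReal.ofReal a₁ • μ₁ + ENNReal.ofReal a₂ • μ₂) Q ≤
      ENNReal.ofReal a₁ * partEntropy μ₁ P₁ + ENNReal.ofReal a₂ * partEntropy μ₂ P₂ + 1 := by
  have := isProbabilityMeasure_mixture ha₁ ha₂ hsum μ₁ μ₂
  have := hP₁.1.to_subtype
  have := hP₂.1.to_subtype
  let A : P₁ ⊕ P₂ → Set X := Sum.elim (↑) (↑)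
  let m : P₁ ⊕ P₂ → Measure X := Sum.elim (fun s => ENNReal.ofReal a₁ • μ₁.restrict s)
    fun s => ENNReal.ofReal a₂ • μ₂.restrict s
  have hA : ∀ i, MeasurableSet (A i) := by
    rintro (s | s)
    exacts [hP₁.2.1 s s.2, hP₂.2.1 s s.2]
  have hAQ : ∀ i, ∃ q ∈ Q, A i ⊆ q := by
    rintro (s | s)
    exacts [hQ₁ s s.2, hQ₂ s s.2]
  have hm : ∀ i, m i (A i)ᶜ = 0 := by
    rintro (s | s)
    · simp [m, A, Measure.restrict_apply (hP₁.2.1 s s.2).compl]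
    · simp [m, A, Measure.restrict_apply (hP₂.2.1 s s.2).compl]
  have hmsum : Measure.sum m = ENNReal.ofReal a₁ • μ₁ + ENNReal.ofReal a₂ • μ₂ := by
    ext t ht
    conv_rhs => rw [← hP₁.sum_restrict, ← hP₂.sum_restrict]
    rw [Measure.sum_apply _ ht, Summable.tsum_sum ENNReal.summable ENNReal.summable]
    simp only [m, Sum.elim_inl, Sum.elim_inr, Measure.add_apply, Measure.smul_apply,
      Measure.sum_apply _ ht, smul_eq_mul, ENNReal.tsum_mul_left]
  refine (entropyH_le_tsum_of_sum_eq _ Q A hA hAQ m hm hmsum).trans ?_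
  rw [Summable.tsum_sum ENNReal.summable ENNReal.summable]
  simp only [m, Sum.elim_inl, Sum.elim_inr, Measure.smul_apply, Measure.restrict_apply_univ,
    smul_eq_mul]
  rw [hP₁.tsum_sh_smul ha₁ (by linarith), hP₂.tsum_sh_smul ha₂ (by linarith), add_add_add_comm,
    ← ENNReal.ofReal_add (sh_nonneg ha₁ (by linarith)) (sh_nonneg ha₂ (by linarith))]
  gcongr
  exact ENNReal.ofReal_le_one.2 (sh_add_sh_le_one hsum)

/-- Corollary 1 of the paper: for two probability measures `μ₁, μ₂` and
`a₁, a₂ ∈ (0,1)` with `a₁ + a₂ = 1`,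
`a₁H(μ₁;Q) + a₂H(μ₂;Q) ≤ H(a₁μ₁ + a₂μ₂;Q) ≤ a₁H(μ₁;Q) + a₂H(μ₂;Q) + 1`. -/
theorem entropyH_two_mixture {X : Type*} [MeasurableSpace X]
    (a₁ a₂ : ℝ) (ha₁ : a₁ ∈ Set.Ioo (0 : ℝ) 1) (ha₂ : a₂ ∈ Set.Ioo (0 : ℝ) 1)
    (hsum : a₁ + a₂ = 1)
    (μ₁ μ₂ : Measure X) [IsProbabilityMeasure μ₁] [IsProbabilityMeasure μ₂]
    (Q : Set (Set X)) (hQ : ∀ q ∈ Q, MeasurableSet q) :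
    ENNReal.ofReal a₁ * entropyH μ₁ Q + ENNReal.ofReal a₂ * entropyH μ₂ Q ≤
      entropyH (ENNReal.ofReal a₁ • μ₁ + ENNReal.ofReal a₂ • μ₂) Q ∧
    entropyH (ENNReal.ofReal a₁ • μ₁ + ENNReal.ofReal a₂ • μ₂) Q ≤
      ENNReal.ofReal a₁ * entropyH μ₁ Q + ENNReal.ofReal a₂ * entropyH μ₂ Q + 1 := by
  have h₁ : ENNReal.ofReal a₁ ≠ 0 := (ENNReal.ofReal_pos.2 ha₁.1).ne'
  have h₂ : ENNReal.ofReal a₂ ≠ 0 := (ENNReal.ofReal_pos.2 ha₂.1).ne'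
  constructor
  · refine le_iInf fun P => le_iInf fun hP => le_iInf fun hPQ => ?_
    obtain ⟨hc, hmeas, hd, h0⟩ := hP
    have h0' : μ₁ (⋃₀ P)ᶜ = 0 ∧ μ₂ (⋃₀ P)ᶜ = 0 := by
      rw [Measure.add_apply, Measure.smul_apply, Measure.smul_apply, add_eq_zero] at h0
      exact ⟨(mul_eq_zero.1 h0.1).resolve_left h₁, (mul_eq_zero.1 h0.2).resolve_left h₂⟩
    refine le_trans ?_ (le_partEntropy_mixture ha₁.1.le ha₂.1.le hsum μ₁ μ₂ P)
    gcongr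
    · exact iInf_le_of_le P (iInf_le_of_le ⟨hc, hmeas, hd, h0'.1⟩ (iInf_le _ hPQ))
    · exact iInf_le_of_le P (iInf_le_of_le ⟨hc, hmeas, hd, h0'.2⟩ (iInf_le _ hPQ))
  · conv_rhs => rw [entropyH, entropyH]
    simp only [ENNReal.mul_iInf_of_ne h₁ ofReal_ne_top, ENNReal.mul_iInf_of_ne h₂ ofReal_ne_top,
      ENNReal.iInf_add, ENNReal.add_iInf, le_iInf_iff]
    intros
    apply entropyH_mixture_le ha₁.1.le ha₂.1.le hsum <;> assumption
end
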